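/- For every integer r ≥ 3 and every ε > 0, there exists a (bipartite) graph G with maximum degree r − 1 such that r < χ''_c(G) < r + ε. Hence every integer r ≥ 3 is an accumulation point of the set {χ''_c(G) : G a finite graph}. -/

import Mathlib

open SimpleGraph

/-- A proper total colouring of `G` with `p` colours: vertex colours `cv`,
edge colours `ce` (symmetric on adjacent pairs); adjacent vertices, adjacent
edges and incident vertex-edge pairs get distinct colours. -/
def IsTotalColoring {V : Type*} (G : SimpleGraph V) (p : ℕ)
    (cv : V → Fin p) (ce : V → V → Fin p) : Prop :=
  (∀ u v, G.Adj u v → ce u v = ce v u) ∧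
  (∀ u v, G.Adj u v → cv u ≠ cv v) ∧
  (∀ u v w, G.Adj u v → G.Adj u w → v ≠ w → ce u v ≠ ce u w) ∧
  (∀ u v, G.Adj u v → ce u v ≠ cv u ∧ ce u v ≠ cv v)

/-- circular distance condition: `q ≤ |a - b| ≤ p - q`. -/
def circOk (p q a b : ℕ) : Prop :=
  q ≤ max a b - min a b ∧ max a b - min a b ≤ p - q

/-- A `(p,q)`-total colouring of `G`. -/
def IsCircTotalColoring {V : Type*} (G : SimpleGraph V) (p q : ℕ)
    (cv : V → ℕ) (ce : V → V → ℕ) : Prop :=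
  (∀ v, cv v < p) ∧
  (∀ u v, G.Adj u v → ce u v < p) ∧
  (∀ u v, G.Adj u v → ce u v = ce v u) ∧
  (∀ u v, G.Adj u v → circOk p q (cv u) (cv v)) ∧
  (∀ u v w, G.Adj u v → G.Adj u w → v ≠ w → circOk p q (ce u v) (ce u w)) ∧
  (∀ u v, G.Adj u v → circOk p q (ce u v) (cv u) ∧ circOk p q (ce u v) (cv v))

/-- The circular total chromatic number of `G`. -/
noncomputable def circTotalChromatic {V : Type*} (G : SimpleGraph V) : ℝ :=
  sInf {x : ℝ | ∃ p q : ℕ, 0 < q ∧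
    (∃ cv ce, IsCircTotalColoring G p q cv ce) ∧ x = (p : ℝ) / q}

/-- The chain graph `G_{k,n}`: `n` blocks, each a copy of `K_{k,k-1}` with
partite sets `Fin k` (the `X`-side) and `Fin (k-1)` (the `Y`-side); in block `i`
the designated link vertices are `x_i = (i, inl 0)` and `x'_i = (i, inl 1)`;
the extra vertex `u` is `none`, joined to `x'_1` and `x_n`, and `x_i` is joined
to `x'_{i+1}`. -/
def Gkn (k n : ℕ) : SimpleGraph (Option (Fin n × (Fin k ⊕ Fin (k - 1)))) :=
  SimpleGraph.fromRel (fun a b =>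
    (∃ (i : Fin n) (x : Fin k) (y : Fin (k - 1)),
        a = some (i, Sum.inl x) ∧ b = some (i, Sum.inr y)) ∨
    (∃ (i j : Fin n) (x x' : Fin k), (j : ℕ) = (i : ℕ) + 1 ∧ (x : ℕ) = 0 ∧ (x' : ℕ) = 1 ∧
        a = some (i, Sum.inl x) ∧ b = some (j, Sum.inl x')) ∨
    (∃ (i : Fin n) (x' : Fin k), (i : ℕ) = 0 ∧ (x' : ℕ) = 1 ∧
        a = none ∧ b = some (i, Sum.inl x')) ∨
    (∃ (i : Fin n) (x : Fin k), (i : ℕ) = n - 1 ∧ (x : ℕ) = 0 ∧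
        a = some (i, Sum.inl x) ∧ b = none))

/-! ### Rounding circular colourings -/

/-- If `p / q < r + 1 / (M + 1)` and at most `M` colours of a circular colouring are used, then the
used colours can be rounded to `r` colours so that far apart colours remain distinct. -/
lemma exists_rounding {p q r M : ℕ} (hr : 0 < r) (hq : 0 < q) (S : Finset ℕ) (hS : ∀ c ∈ S, c < p)
    (hM : S.card ≤ M) (hlt : p * (M + 1) < q * (r * (M + 1) + 1)) :
    ∃ ρ : ℕ → ℕ, (∀ c ∈ S, ρ c < r) ∧ ∀ c ∈ S, ∀ d ∈ S, circOk p q c d → ρ c ≠ ρ d := by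
  obtain ⟨t, s, hps, hgap⟩ : ∃ t s : ℕ, p ≤ r * q + s ∧ ((s = 0 ∧ t = 0) ∨ (p = r * q + s ∧
      t + s ≤ q ∧ ∀ c ∈ S, c < t ∨ t + s ≤ c)) := by
    rcases Nat.lt_or_ge (r * q) p with h | h
    · obtain ⟨s, rfl⟩ := Nat.exists_eq_add_of_lt h
      have hcard : (S.image (· / (s + 1))).card < (Finset.range (M + 1)).card := by
        rw [Finset.card_range]
        exact Nat.lt_succ_of_le (Finset.card_image_le.trans hM)
      obtain ⟨j, hj, hjS⟩ := Finset.exists_mem_notMem_of_card_lt_card hcard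
      refine ⟨j * (s + 1), s + 1, le_of_eq (by ring), Or.inr ⟨by ring, ?_, fun c hc => ?_⟩⟩
      · have h1 : j + 1 ≤ M + 1 := by simpa using hj
        have h2 := Nat.mul_le_mul_right (s + 1) h1
        nlinarith
      · by_contra! hcon
        refine hjS (Finset.mem_image.2 ⟨c, hc, ?_⟩)
        exact Nat.div_eq_of_lt_le hcon.1 (by linarith [hcon.2])
    · exact ⟨0, 0, by simpa using h, Or.inl ⟨rfl, rfl⟩⟩
  have hrq : q ≤ r * q := Nat.le_mul_of_pos_left q hr
  have hdiv : ∀ a b : ℕ, a + q ≤ b → a / q ≠ b / q := fun a b hab => by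
    have := Nat.div_le_div_right (c := q) hab
    rw [Nat.add_div_right _ hq] at this
    omega
  refine ⟨fun c => (if t + s ≤ c then c - (t + s) else c + p - (t + s)) / q, fun c hc => ?_,
    fun c hc d hd hcd => ?_⟩
  · have := hS c hc
    rw [Nat.div_lt_iff_lt_mul hq]
    rcases hgap with ⟨rfl, rfl⟩ | ⟨rfl, -, hg⟩
    · simp; omega
    · rcases hg c hc with h | h <;> split_ifs <;> omega
  · have hc' := hS c hc
    have hd' := hS d hd
    obtain ⟨h1, h2⟩ := hcd
    have key : ∀ a b : ℕ, a + q ≤ b ∨ b + q ≤ a → a / q ≠ b / q := fun a b h =>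
      h.elim (hdiv a b) fun h => (hdiv b a h).symm
    apply key
    rcases le_total c d with hle | hle
    · rw [max_eq_right hle, min_eq_left hle] at h1 h2
      split_ifs <;> omega
    · rw [max_eq_left hle, min_eq_right hle] at h1 h2
      split_ifs <;> omega

/-- A finite graph without a total colouring with `r` colours has circular total chromatic number
bounded away from `r`. -/
lemma lt_circTotalChromatic {V : Type*} [Fintype V] {G : SimpleGraph V} {r : ℕ} (hr : 0 < r)
    (hG : ∀ cv ce, ¬ IsTotalColoring G r cv ce)
    (hne : ∃ p q cv ce, 0 < q ∧ IsCircTotalColoring G p q cv ce) :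
    (r : ℝ) < circTotalChromatic G := by
  classical
  set M := Fintype.card V + Fintype.card (V × V) with hMdef
  have hpos : (0 : ℝ) < 1 / (M + 1) := by positivity
  refine lt_of_lt_of_le (lt_add_of_pos_right _ hpos) (le_csInf ?_ ?_)
  · obtain ⟨p, q, cv, ce, hq, h⟩ := hne
    exact ⟨_, p, q, hq, ⟨cv, ce, h⟩, rfl⟩
  rintro _ ⟨p, q, hq, ⟨cv, ce, hv, he, hsymm, hvv, hee, hev⟩, rfl⟩
  by_contra! hcon
  have hlt : p * (M + 1) < q * (r * (M + 1) + 1) := by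
    have hq' : (0 : ℝ) < q := by exact_mod_cast hq
    rw [div_lt_iff₀ hq'] at hcon
    have hM' : (0 : ℝ) < M + 1 := by positivity
    have := mul_lt_mul_of_pos_right hcon hM'
    have h2 : ((r : ℝ) + 1 / (M + 1)) * q * (M + 1) = q * (r * (M + 1) + 1) := by
      field_simp
    rw [h2] at this
    exact_mod_cast this
  let S : Finset ℕ := Finset.univ.image cv ∪
    (Finset.univ.filter fun a : V × V => G.Adj a.1 a.2).image fun a => ce a.1 a.2
  have hcvS : ∀ v, cv v ∈ S := fun v =>
    Finset.mem_union_left _ (Finset.mem_image_of_mem _ (Finset.mem_univ v))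
  have hceS : ∀ u v, G.Adj u v → ce u v ∈ S := fun u v h =>
    Finset.mem_union_right _ (Finset.mem_image.2 ⟨(u, v), by simpa using h, rfl⟩)
  have hSM : S.card ≤ M := (Finset.card_union_le _ _).trans <|
    Nat.add_le_add Finset.card_image_le (Finset.card_image_le.trans (Finset.card_filter_le _ _))
  have hSp : ∀ c ∈ S, c < p := by
    intro c hc
    rcases Finset.mem_union.1 hc with hc | hc
    · obtain ⟨v, -, rfl⟩ := Finset.mem_image.1 hc
      exact hv v
    · obtain ⟨a, ha, rfl⟩ := Finset.mem_image.1 hc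
      exact he _ _ (by simpa using ha)
  obtain ⟨ρ, hρ, hne'⟩ := exists_rounding hr hq S hSp hSM hlt
  let f : ℕ → Fin r := fun c => ⟨ρ c % r, Nat.mod_lt _ hr⟩
  have hf : ∀ c ∈ S, ∀ d ∈ S, circOk p q c d → f c ≠ f d := by
    intro c hc d hd hcd heq
    have := congrArg Fin.val heq
    simp only [f, Nat.mod_eq_of_lt (hρ c hc), Nat.mod_eq_of_lt (hρ d hd)] at this
    exact hne' c hc d hd hcd this
  refine hG (fun v => f (cv v)) (fun u v => f (ce u v)) ⟨?_, ?_, ?_, ?_⟩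
  · exact fun u v h => congrArg f (hsymm u v h)
  · exact fun u v h => hf _ (hcvS u) _ (hcvS v) (hvv u v h)
  · exact fun u v w h h' hvw => hf _ (hceS u v h) _ (hceS u w h') (hee u v w h h' hvw)
  · exact fun u v h => ⟨hf _ (hceS u v h) _ (hcvS u) (hev u v h).1,
      hf _ (hceS u v h) _ (hcvS v) (hev u v h).2⟩

lemma circTotalChromatic_le {V : Type*} {G : SimpleGraph V} {p q : ℕ} {cv ce} (hq : 0 < q)
    (h : IsCircTotalColoring G p q cv ce) : circTotalChromatic G ≤ (p : ℝ) / q := by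
  refine csInf_le ⟨0, ?_⟩ ⟨p, q, hq, ⟨cv, ce, h⟩, rfl⟩
  rintro _ ⟨p, q, -, -, rfl⟩
  positivity

/-! ### Invariance under isomorphism -/

lemma IsCircTotalColoring.comap {V W : Type*} {G : SimpleGraph V} {H : SimpleGraph W}
    (f : G ↪g H) {p q : ℕ} {cv ce} (h : IsCircTotalColoring H p q cv ce) :
    IsCircTotalColoring G p q (fun v => cv (f v)) (fun u v => ce (f u) (f v)) := by
  obtain ⟨hv, he, hsymm, hvv, hee, hev⟩ := h
  have hf : ∀ {u v}, G.Adj u v → H.Adj (f u) (f v) := fun h => f.map_adj_iff.2 h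
  exact ⟨fun v => hv _, fun u v h => he _ _ (hf h), fun u v h => hsymm _ _ (hf h),
    fun u v h => hvv _ _ (hf h),
    fun u v w h h' hvw => hee _ _ _ (hf h) (hf h') (f.injective.ne hvw),
    fun u v h => hev _ _ (hf h)⟩

lemma circTotalChromatic_congr {V W : Type*} {G : SimpleGraph V} {H : SimpleGraph W}
    (f : G ≃g H) : circTotalChromatic G = circTotalChromatic H := by
  unfold circTotalChromatic
  congr 1
  ext x
  constructor
  · rintro ⟨p, q, hq, ⟨cv, ce, h⟩, rfl⟩
    exact ⟨p, q, hq, ⟨_, _, h.comap f.symm.toEmbedding⟩, rfl⟩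
  · rintro ⟨p, q, hq, ⟨cv, ce, h⟩, rfl⟩
    exact ⟨p, q, hq, ⟨_, _, h.comap f.toEmbedding⟩, rfl⟩

/-! ### Total colourings of `K_{n+1,n}` with `n + 2` colours -/

/-- In a total colouring of the complete bipartite graph with parts `X`, `Y`, `|X| = |Y| + 1`, with
`|Y| + 2` colours, the colour not seen at a vertex of `X` is the same for all vertices of `X`. -/
lemma exists_common_missing {X Y C : Type*} [Fintype X] [Fintype Y] [Fintype C]
    (hX : Fintype.card X = Fintype.card Y + 1) (hC : Fintype.card C = Fintype.card Y + 2)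
    (a : X → C) (b : Y → C) (e : X → Y → C) (hab : ∀ x y, a x ≠ b y)
    (hex : ∀ x y y', y ≠ y' → e x y ≠ e x y') (hey : ∀ x x' y, x ≠ x' → e x y ≠ e x' y)
    (hea : ∀ x y, e x y ≠ a x) (heb : ∀ x y, e x y ≠ b y) :
    ∃ c, ∀ x l, l ≠ a x → (∀ y, l ≠ e x y) → l = c := by
  classical
  have hsurj : ∀ y c, c ≠ b y → ∃ x, e x y = c := by
    intro y c hc
    have hinj : Function.Injective (fun o : Option X => o.elim (b y) fun x => e x y) := by
      rintro (_ | x) (_ | x') h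
      · rfl
      · exact absurd h.symm (heb x' y)
      · exact absurd h (heb x y)
      · by_contra hne
        exact hey x x' y (fun h' => hne (congrArg some h')) h
    have hbij := (Fintype.bijective_iff_injective_and_card _).2
      ⟨hinj, by rw [Fintype.card_option, hX, hC]⟩
    obtain ⟨o, ho⟩ := hbij.2 c
    cases o with
    | none => exact absurd ho.symm hc
    | some x => exact ⟨x, ho⟩
  have hainj : Function.Injective a := by
    intro x x' hxx
    by_contra hne
    choose g hg using fun y => hsurj y (a x) (hab x y)
    have hginj : Function.Injective g := by
      intro y y' h
      by_contra hyy
      exact hex (g y) y y' hyy (by rw [hg, h, hg])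
    have hsub : Finset.univ.image g ⊆ (Finset.univ.erase x).erase x' := by
      intro z hz
      obtain ⟨y, -, rfl⟩ := Finset.mem_image.1 hz
      simp only [Finset.mem_erase, Finset.mem_univ, and_true]
      refine ⟨fun h => hea x' y ?_, fun h => hea x y ?_⟩
      · rw [← hxx, ← h, hg]
      · conv_lhs => rw [← h, hg]
    have := Finset.card_le_card hsub
    rw [Finset.card_image_of_injective _ hginj, Finset.card_erase_of_mem
      (by simpa using fun h => hne h.symm), Finset.card_erase_of_mem (Finset.mem_univ _),
      Finset.card_univ, Finset.card_univ, hX] at this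
    have : 0 < Fintype.card X - 1 := by
      have : 1 < Fintype.card X := Fintype.one_lt_card_iff.2 ⟨x, x', hne⟩
      omega
    omega
  have hcard : ((Finset.univ.image a)ᶜ : Finset C).card = 1 := by
    rw [Finset.card_compl, Finset.card_image_of_injective _ hainj, Finset.card_univ, hX, hC]
    omega
  obtain ⟨c, hc⟩ := Finset.card_eq_one.1 hcard
  have hmem : ∀ d, (∀ x, a x ≠ d) ↔ d = c := by
    intro d
    rw [← Finset.mem_singleton, ← hc]
    simp
  have hb : ∀ y, b y = c := fun y => (hmem _).1 fun x => hab x y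
  refine ⟨c, fun x l hla hle => ?_⟩
  by_contra hlc
  have hinj : Function.Injective
      (fun o : Option (Option (Option Y)) =>
        o.elim l fun o => o.elim c fun o => o.elim (a x) (e x)) := by
    have hca : c ≠ a x := fun h => (hmem c).2 rfl x h.symm
    have hec : ∀ y, e x y ≠ c := fun y => hb y ▸ heb x y
    have he : ∀ y y', e x y = e x y' → y = y' := fun y y' h => by
      by_contra hyy
      exact hex x y y' hyy h
    rintro (_ | _ | _ | y) (_ | _ | _ | y') h <;> simp only [Option.elim] at h <;> grind
  have := Fintype.card_le_of_injective _ hinj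
  simp only [Fintype.card_option, hC] at this
  omega

/-! ### The chain graph -/

/-- The chain of `N` copies of `K_{m+1,m}` closed up through an extra vertex `none`. The vertex
`(i, inl 0)` is joined to `(i + 1, inl (last m))`, and `none` is joined to the two free ends. -/
def chainGraph (m N : ℕ) : SimpleGraph (Option (Fin N × (Fin (m + 1) ⊕ Fin m))) :=
  SimpleGraph.mk (fun u v => match u, v with
    | none, some (i, .inl x) | some (i, .inl x), none =>
      (i.val = 0 ∧ x.val = m) ∨ (i.val + 1 = N ∧ x.val = 0)
    | some (i, .inl x), some (j, .inr _) | some (j, .inr _), some (i, .inl x) => i = j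
    | some (i, .inl x), some (j, .inl x') =>
      (i.val + 1 = j.val ∧ x.val = 0 ∧ x'.val = m) ∨ (j.val + 1 = i.val ∧ x'.val = 0 ∧ x.val = m)
    | _, _ => False)
  (by
    constructor
    rintro (_ | ⟨i, x | y⟩) (_ | ⟨j, x' | y'⟩) h <;> simp only at h ⊢ <;> grind)
  (by
    constructor
    rintro (_ | ⟨i, x | y⟩) h <;> simp only at h
    grind)

lemma chainGraph_colorable (m q : ℕ) : (chainGraph m (2 * q + 1)).Colorable 2 := by
  refine ⟨SimpleGraph.Coloring.mk (fun v => match v with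
    | none => (0 : Fin 2)
    | some (i, .inl _) => ⟨(i.val + 1) % 2, Nat.mod_lt _ two_pos⟩
    | some (i, .inr _) => ⟨i.val % 2, Nat.mod_lt _ two_pos⟩) ?_⟩
  rintro (_ | ⟨i, x | y⟩) (_ | ⟨j, x' | y'⟩) h <;>
    simp only [chainGraph] at h <;> simp only [ne_eq, Fin.ext_iff, Fin.val_zero] <;> grind

lemma chainGraph_ncard_neighborSet_le {m N : ℕ} (hm : 1 ≤ m)
    (v : Option (Fin N × (Fin (m + 1) ⊕ Fin m))) :
    ((chainGraph m N).neighborSet v).ncard ≤ m + 1 := by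
  rcases v with _ | ⟨i, x | y⟩
  · rcases Nat.eq_zero_or_pos N with rfl | hN
    · have : (chainGraph m 0).neighborSet none = ∅ := by
        ext (_ | ⟨i, -⟩)
        · simp
        · exact i.elim0
      rw [this, Set.ncard_empty]
      omega
    · have hsub : (chainGraph m N).neighborSet none ⊆
          {some (⟨0, hN⟩, .inl (Fin.last m)), some (⟨N - 1, by omega⟩, .inl 0)} := by
        rintro (_ | ⟨j, x' | y'⟩) h <;> simp only [SimpleGraph.mem_neighborSet, chainGraph] at h
        simp only [Set.mem_insert_iff, Set.mem_singleton_iff, Option.some.injEq, Prod.mk.injEq,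
          Sum.inl.injEq, Fin.ext_iff, Fin.val_last, Fin.val_zero]
        omega
      have := (Set.ncard_le_ncard hsub).trans (Set.ncard_insert_le _ _)
      rw [Set.ncard_singleton] at this
      omega
  · obtain ⟨w, hw⟩ : ∃ w, (chainGraph m N).neighborSet (some (i, .inl x)) ⊆
        insert w (Set.range fun y : Fin m => some (i, .inr y)) := by
      by_cases hlink : ∃ w, (chainGraph m N).Adj (some (i, .inl x)) w ∧
          ∀ y, w ≠ some (i, .inr y)
      · obtain ⟨w, hw, hwy⟩ := hlink
        refine ⟨w, ?_⟩
        rintro (_ | ⟨j, x' | y'⟩) h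
        · rcases w with _ | ⟨j', x'' | y''⟩ <;>
            simp only [SimpleGraph.mem_neighborSet, chainGraph] at h hw <;> grind
        · rcases w with _ | ⟨j', x'' | y''⟩ <;>
            simp only [SimpleGraph.mem_neighborSet, chainGraph] at h hw <;> grind
        · simp only [SimpleGraph.mem_neighborSet, chainGraph] at h
          subst h
          exact Or.inr ⟨y', rfl⟩
      · push Not at hlink
        refine ⟨none, fun w hw => ?_⟩
        obtain ⟨y, rfl⟩ := hlink w hw
        exact Or.inr ⟨y, rfl⟩
    refine (Set.ncard_le_ncard hw).trans ((Set.ncard_insert_le _ _).trans ?_)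
    rw [← Set.image_univ]
    have := Set.ncard_image_le Set.finite_univ (f := fun y : Fin m => (some (i, Sum.inr y) :
      Option (Fin N × (Fin (m + 1) ⊕ Fin m))))
    rw [Set.ncard_univ, Nat.card_fin] at this
    omega
  · have hsub : (chainGraph m N).neighborSet (some (i, .inr y)) ⊆
        Set.image (fun x : Fin (m + 1) => some (i, Sum.inl x)) Set.univ := by
      rintro (_ | ⟨j, x' | y'⟩) h <;> simp only [SimpleGraph.mem_neighborSet, chainGraph] at h
      subst h
      simp
    refine (Set.ncard_le_ncard hsub).trans ((Set.ncard_image_le Set.finite_univ).trans ?_)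
    simp

lemma chainGraph_ncard_neighborSet_inr {m N : ℕ} (i : Fin N) (y : Fin m) :
    ((chainGraph m N).neighborSet (some (i, .inr y))).ncard = m + 1 := by
  have : (chainGraph m N).neighborSet (some (i, .inr y)) =
      Set.range (fun x : Fin (m + 1) => some (i, Sum.inl x)) := by
    ext (_ | ⟨j, x' | y'⟩) <;> simp [chainGraph, eq_comm]
  rw [this, ← Set.image_univ, Set.ncard_image_of_injective _ (fun x x' h => by simpa using h)]
  simp

lemma chainGraph_not_isTotalColoring {m N : ℕ} (hm : 1 ≤ m) (hN : 1 ≤ N) (cv ce) :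
    ¬ IsTotalColoring (chainGraph m N) (m + 2) cv ce := by
  rintro ⟨hsymm, hvv, hee, hev⟩
  have hblock : ∀ i : Fin N, ∃ c, ∀ x w, (chainGraph m N).Adj (some (i, .inl x)) w →
      (∀ y, w ≠ some (i, .inr y)) → ce (some (i, .inl x)) w = c := by
    intro i
    have hadj : ∀ x y, (chainGraph m N).Adj (some (i, .inl x)) (some (i, .inr y)) :=
      fun x y => by simp [chainGraph]
    obtain ⟨c, hc⟩ := exists_common_missing (X := Fin (m + 1)) (Y := Fin m) (C := Fin (m + 2))
      (by simp) (by simp) (fun x => cv (some (i, .inl x))) (fun y => cv (some (i, .inr y)))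
      (fun x y => ce (some (i, .inl x)) (some (i, .inr y)))
      (fun x y => hvv _ _ (hadj x y))
      (fun x y y' h => hee _ _ _ (hadj x y) (hadj x y') (by simpa using h))
      (fun x x' y h => by
        rw [hsymm _ _ (hadj x y), hsymm _ _ (hadj x' y)]
        exact hee _ _ _ (hadj x y).symm (hadj x' y).symm (by simpa using h))
      (fun x y => (hev _ _ (hadj x y)).1) (fun x y => (hev _ _ (hadj x y)).2)
    exact ⟨c, fun x w hw hwy => hc x _ (hev _ _ hw).1 fun y => hee _ _ _ hw (hadj x y) (hwy y)⟩
  choose c hc using hblock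
  have hfirst : (chainGraph m N).Adj none (some (⟨0, hN⟩, .inl (Fin.last m))) := by
    simp [chainGraph]
  have hlast : (chainGraph m N).Adj none (some (⟨N - 1, by omega⟩, .inl 0)) := by
    simp only [chainGraph]
    right
    exact ⟨by omega, rfl⟩
  have hconst : ∀ i (hi : i < N), c ⟨i, hi⟩ = c ⟨0, hN⟩ := by
    intro i
    induction i with
    | zero => exact fun _ => rfl
    | succ i ih =>
      intro hi
      have hadj : (chainGraph m N).Adj (some (⟨i, by omega⟩, .inl 0))
          (some (⟨i + 1, hi⟩, .inl (Fin.last m))) := by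
        simp [chainGraph]
      rw [← ih (by omega), ← hc _ _ _ hadj (by simp), hsymm _ _ hadj,
        hc _ _ _ hadj.symm (by simp)]
  refine hee _ _ _ hfirst hlast ?_ ?_
  · simp only [ne_eq, Option.some.injEq, Prod.mk.injEq, Sum.inl.injEq, Fin.ext_iff, Fin.val_last,
      Fin.val_zero]
    omega
  · rw [hsymm _ _ hfirst, hsymm _ _ hlast, hc _ _ _ hfirst.symm (by simp),
      hc _ _ _ hlast.symm (by simp)]
    exact (hconst _ _).symm

/-! ### Circular colouring of the chain graph -/

/-- Natural numbers whose residues modulo `p` are at circular distance at least `q`. -/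
def CircFar (p q a b : ℕ) : Prop :=
  (a + q ≤ b ∧ b + q ≤ a + p) ∨ (b + q ≤ a ∧ a + q ≤ b + p)

lemma CircFar.circOk_mod {p q a b : ℕ} (hq : 0 < q) (h : CircFar p q a b) :
    circOk p q (a % p) (b % p) := by
  have hp : 0 < p := by unfold CircFar at h; omega
  have aux : ∀ a b : ℕ, a + q ≤ b → b + q ≤ a + p → (b % p + p = a % p + (b - a)) ∨
      b % p = a % p + (b - a) := by
    intro a b h1 h2
    obtain ⟨d, rfl⟩ := Nat.exists_eq_add_of_le (le_of_add_le_left h1)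
    rw [Nat.add_sub_cancel_left]
    have hd : d % p = d := Nat.mod_eq_of_lt (by omega)
    have ha := Nat.mod_lt a hp
    rw [Nat.add_mod, hd]
    rcases Nat.lt_or_ge (a % p + d) p with h | h
    · exact Or.inr (Nat.mod_eq_of_lt h)
    · left
      rw [Nat.mod_eq_sub_mod h, Nat.mod_eq_of_lt (by omega)]
      omega
  have ha := Nat.mod_lt a hp
  have hb := Nat.mod_lt b hp
  unfold circOk
  rcases h with ⟨h1, h2⟩ | ⟨h1, h2⟩
  · have := aux a b h1 h2
    omega
  · have := aux b a h1 h2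
    omega

lemma isCircTotalColoring_mod {V : Type*} {G : SimpleGraph V} {p q : ℕ} (hp : 0 < p) (hq : 0 < q)
    {cv : V → ℕ} {ce : V → V → ℕ} (hsymm : ∀ u v, G.Adj u v → ce u v = ce v u)
    (hvv : ∀ u v, G.Adj u v → CircFar p q (cv u) (cv v))
    (hee : ∀ u v w, G.Adj u v → G.Adj u w → v ≠ w → CircFar p q (ce u v) (ce u w))
    (hev : ∀ u v, G.Adj u v → CircFar p q (ce u v) (cv u)) :
    IsCircTotalColoring G p q (fun v => cv v % p) (fun u v => ce u v % p) := by
  refine ⟨fun v => Nat.mod_lt _ hp, fun u v _ => Nat.mod_lt _ hp, fun u v h => ?_,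
    fun u v h => (hvv u v h).circOk_mod hq,
    fun u v w h h' hvw => (hee u v w h h' hvw).circOk_mod hq,
    fun u v h => ⟨(hev u v h).circOk_mod hq, ?_⟩⟩
  · simp only [hsymm u v h]
  · simp only [hsymm u v h]
    exact (hev v u h.symm).circOk_mod hq

/-- Vertex colours of the chain graph, to be reduced modulo `(m + 2) * q + 1`. -/
def chainVertexColor (m q N : ℕ) : Option (Fin N × (Fin (m + 1) ⊕ Fin m)) → ℕ
  | none => q
  | some (i, .inl x) => i + 1 + (x + 1) * q
  | some (i, .inr _) => i

/-- Edge colours of the chain graph, to be reduced modulo `(m + 2) * q + 1`. -/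
def chainEdgeColor (m q N : ℕ) (u v : Option (Fin N × (Fin (m + 1) ⊕ Fin m))) : ℕ :=
  match u, v with
  | some (i, .inl x), some (_, .inr y) | some (_, .inr y), some (i, .inl x) =>
    i + 1 + ((x + y + 1) % (m + 1) + 1) * q
  | some (i, .inl _), some (j, .inl _) => max i.val j.val
  | none, some (i, _) | some (i, _), none => if i.val = 0 then 0 else N
  | _, _ => 0

lemma circFar_add_mul {m q a b c : ℕ} (ha : a ≤ m) (hb : b ≤ m) (hab : a ≠ b) :
    CircFar ((m + 2) * q + 1) q (c + (a + 1) * q) (c + (b + 1) * q) := by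
  wlog h : a < b generalizing a b
  · exact (this hb ha hab.symm (by omega)).symm
  left
  have h1 := Nat.mul_le_mul_right q h
  have h2 := Nat.mul_le_mul_right q hb
  constructor <;> nlinarith

lemma circFar_mul_left {m q a c d : ℕ} (ha : a ≤ m) (hd : d = c ∨ d = c + 1) :
    CircFar ((m + 2) * q + 1) q d (c + 1 + (a + 1) * q) := by
  left
  have h2 := Nat.mul_le_mul_right q ha
  constructor <;> rcases hd with rfl | rfl <;> nlinarith [Nat.zero_le (a * q)]

lemma CircFar.symm {p q a b : ℕ} (h : CircFar p q a b) : CircFar p q b a := Or.symm h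

lemma chainGraph_isCircTotalColoring {m q : ℕ} (hm : 1 ≤ m) (hq : 0 < q) :
    ∃ cv ce, IsCircTotalColoring (chainGraph m (2 * q + 1)) ((m + 2) * q + 1) q cv ce := by
  have hqm : q ≤ m * q := Nat.le_mul_of_pos_left q hm
  have hmod : ∀ n, n % (m + 1) ≤ m := fun n => Nat.lt_succ_iff.1 (Nat.mod_lt _ m.succ_pos)
  have hmodne : ∀ a b c : ℕ, a ≤ m → b ≤ m → a ≠ b → (a + c) % (m + 1) ≠ (b + c) % (m + 1) := by
    intro a b c ha hb hab h
    have := Nat.ModEq.add_right_cancel' c h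
    rw [Nat.ModEq, Nat.mod_eq_of_lt (by omega), Nat.mod_eq_of_lt (by omega)] at this
    exact hab this
  refine ⟨_, _, isCircTotalColoring_mod (Nat.succ_pos _) hq (cv := chainVertexColor m q _)
    (ce := chainEdgeColor m q _) ?_ ?_ ?_ ?_⟩
  · rintro (_ | ⟨i, x | y⟩) (_ | ⟨j, x' | y'⟩) h <;> simp only [chainGraph] at h <;>
      simp only [chainEdgeColor, max_comm]
  · have hu : ∀ (i : Fin (2 * q + 1)) (x : Fin (m + 1)),
        (i.val = 0 ∧ x.val = m) ∨ (i.val + 1 = 2 * q + 1 ∧ x.val = 0) →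
        CircFar ((m + 2) * q + 1) q q (i + 1 + (x + 1) * q) := by
      rintro i x (⟨hi, hx⟩ | ⟨hi, hx⟩)
      · rw [hi, hx]
        left
        constructor <;> nlinarith
      · rw [hi, hx]
        left
        constructor <;> nlinarith
    have hl : ∀ (i j : Fin (2 * q + 1)) (x x' : Fin (m + 1)),
        i.val + 1 = j.val ∧ x.val = 0 ∧ x'.val = m →
        CircFar ((m + 2) * q + 1) q (i + 1 + (x + 1) * q) (j + 1 + (x' + 1) * q) := by
      rintro i j x x' ⟨hi, hx, hx'⟩
      rw [← hi, hx, hx']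
      left
      constructor <;> nlinarith
    rintro (_ | ⟨i, x | y⟩) (_ | ⟨j, x' | y'⟩) h <;> simp only [chainGraph] at h <;>
      simp only [chainVertexColor]
    · exact hu j x' h
    · exact (hu i x h).symm
    · exact h.elim (hl i j x x') fun h => (hl j i x' x h).symm
    · subst h
      exact (circFar_mul_left x.is_le (Or.inl rfl)).symm
    · subst h
      exact circFar_mul_left x'.is_le (Or.inl rfl)
  · have hends : CircFar ((m + 2) * q + 1) q 0 (2 * q + 1) := by
      left
      constructor <;> nlinarith
    rintro (_ | ⟨i, x | y⟩) (_ | ⟨j, x' | y'⟩) (_ | ⟨l, x'' | y''⟩) h h' hne <;>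
      simp only [chainGraph] at h h' <;> simp only [chainEdgeColor]
    · have := j.isLt
      have := l.isLt
      rcases h with ⟨hj, hx⟩ | ⟨hj, hx⟩ <;> rcases h' with ⟨hl, hx'⟩ | ⟨hl, hx'⟩
      · exact absurd (by simp [Fin.ext_iff, hj, hl, hx, hx']) hne
      · rw [if_pos hj, if_neg (by omega)]
        exact hends
      · rw [if_neg (by omega), if_pos hl]
        exact hends.symm
      · refine absurd ?_ hne
        simp only [Option.some.injEq, Prod.mk.injEq, Sum.inl.injEq, Fin.ext_iff]
        omega
    · exact absurd rfl hne
    · have := l.isLt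
      omega
    · subst h'
      exact circFar_mul_left (hmod _) (by split_ifs <;> omega)
    · have := j.isLt
      omega
    · have := j.isLt
      have := l.isLt
      refine absurd ?_ hne
      simp only [Option.some.injEq, Prod.mk.injEq, Sum.inl.injEq, Fin.ext_iff]
      omega
    · subst h'
      exact circFar_mul_left (hmod _) (by omega)
    · subst h
      exact (circFar_mul_left (hmod _) (by split_ifs <;> omega)).symm
    · subst h
      exact (circFar_mul_left (hmod _) (by omega)).symm
    · subst h h'
      refine circFar_add_mul (hmod _) (hmod _) ?_
      have hyy : y'.val ≠ y''.val := fun h => hne (by rw [Fin.ext h])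
      have := hmodne y' y'' (x + 1) (by omega) (by omega) hyy
      grind
    · subst h h'
      refine circFar_add_mul (hmod _) (hmod _) ?_
      have hxx : x'.val ≠ x''.val := fun h => hne (by rw [Fin.ext h])
      have := hmodne x' x'' (y + 1) x'.is_le x''.is_le hxx
      grind
  · have hu : ∀ i : Fin (2 * q + 1),
        CircFar ((m + 2) * q + 1) q (if i.val = 0 then 0 else 2 * q + 1) q := by
      intro i
      split_ifs
      · left
        constructor <;> nlinarith
      · right
        constructor <;> nlinarith
    rintro (_ | ⟨i, x | y⟩) (_ | ⟨j, x' | y'⟩) h <;> simp only [chainGraph] at h <;>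
      simp only [chainVertexColor, chainEdgeColor]
    · exact hu j
    · exact circFar_mul_left x.is_le (by split_ifs <;> omega)
    · exact circFar_mul_left x.is_le (by omega)
    · refine circFar_add_mul (hmod _) x.is_le fun h => ?_
      have := hmodne 0 (y' + 1) x (by omega) (by omega) (by omega)
      rw [zero_add, Nat.mod_eq_of_lt x.isLt] at this
      grind
    · subst h
      exact (circFar_mul_left (hmod _) (Or.inl rfl)).symm

/-! ### The main result -/

lemma exists_graph_circTotalChromatic_near {r : ℕ} (hr : 3 ≤ r) {ε : ℝ} (hε : 0 < ε) :
    ∃ (V : Type) (_ : Fintype V) (G : SimpleGraph V),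
      G.Colorable 2 ∧
      (∀ v, (G.neighborSet v).ncard ≤ r - 1) ∧
      (∃ v, (G.neighborSet v).ncard = r - 1) ∧
      (r : ℝ) < circTotalChromatic G ∧ circTotalChromatic G < (r : ℝ) + ε := by
  obtain ⟨m, rfl⟩ := Nat.exists_eq_add_of_le' (show 2 ≤ r by omega)
  have hm : 1 ≤ m := by omega
  obtain ⟨n, hn⟩ := exists_nat_one_div_lt hε
  obtain ⟨cv, ce, h⟩ := chainGraph_isCircTotalColoring hm n.succ_pos
  refine ⟨_, inferInstance, chainGraph m (2 * (n + 1) + 1), chainGraph_colorable m (n + 1),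
    chainGraph_ncard_neighborSet_le hm, ⟨_, chainGraph_ncard_neighborSet_inr 0 ⟨0, hm⟩⟩,
    lt_circTotalChromatic (by omega) (chainGraph_not_isTotalColoring hm (by omega))
      ⟨_, _, cv, ce, n.succ_pos, h⟩, ?_⟩
  refine (circTotalChromatic_le n.succ_pos h).trans_lt ?_
  have : (((m + 2) * (n + 1) + 1 : ℕ) : ℝ) / ((n + 1 : ℕ) : ℝ) =
      (m + 2 : ℕ) + 1 / ((n : ℝ) + 1) := by
    have : (n : ℝ) + 1 ≠ 0 := by positivity
    push_cast
    field_simp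
  rw [Nat.succ_eq_add_one, this]
  linarith

theorem stmt19 :
    (∀ r : ℕ, 3 ≤ r → ∀ ε : ℝ, 0 < ε →
      ∃ (V : Type) (_ : Fintype V) (G : SimpleGraph V),
        G.Colorable 2 ∧
        (∀ v, (G.neighborSet v).ncard ≤ r - 1) ∧
        (∃ v, (G.neighborSet v).ncard = r - 1) ∧
        (r : ℝ) < circTotalChromatic G ∧ circTotalChromatic G < (r : ℝ) + ε) ∧
    (∀ r : ℕ, 3 ≤ r →
      (r : ℝ) ∈ closure
        ({x : ℝ | ∃ (m : ℕ) (G : SimpleGraph (Fin m)), x = circTotalChromatic G}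
          \ {(r : ℝ)})) := by
  refine ⟨fun r hr ε hε => exists_graph_circTotalChromatic_near hr hε, fun r hr => ?_⟩
  refine Metric.mem_closure_iff.2 fun ε hε => ?_
  obtain ⟨V, _, G, -, -, -, hlt, hlt'⟩ := exists_graph_circTotalChromatic_near hr hε
  refine ⟨circTotalChromatic G, ⟨⟨Fintype.card V, G.map (Fintype.equivFin V).toEmbedding,
    circTotalChromatic_congr (SimpleGraph.Iso.map (Fintype.equivFin V) G)⟩, hlt.ne'⟩, ?_⟩
  rw [_root_.dist_comm, Real.dist_eq, abs_of_pos (by linarith)]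
  linarith
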